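/- In the setting of the interpolation step — (Ω, ℱ, μ) a probability space, A, B : Ω → ℝ measurable with 0 < A ≤ B a.e., μ({A < B}) > 0, A⁻¹ integrable, g(γ) = ∫ A^(γ−1)·B^(−γ) dμ, T_n < T_{n+1}, and B₀ : [T_n, T_{n+1}] → ℝ continuous strictly decreasing with B₀(T_n) = g(0), B₀(T_{n+1}) = g(1) — the unique function γ : [T_n, T_{n+1}] → [0,1] satisfying g(γ(T)) = B₀(T) for all T is strictly increasing and continuous on [T_n, T_{n+1}]. -/

import Mathlib

open MeasureTheory Real

/-- The geometric interpolation weight `a ^ (γ - 1) * b ^ (-γ)` is `a⁻¹ * (a / b) ^ γ`. -/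
theorem rpow_sub_one_mul_rpow_neg {a b : ℝ} (ha : 0 < a) (hb : 0 < b) (γ : ℝ) :
    a ^ (γ - 1) * b ^ (-γ) = a⁻¹ * (a / b) ^ γ := by
  rw [rpow_sub_one ha.ne', rpow_neg hb.le, div_rpow ha.le hb.le]
  ring

/-- The expected reciprocal of the geometric interpolation between `A ≤ B` is strictly
decreasing in the interpolation parameter as soon as `A < B` has positive probability. -/
theorem strictAntiOn_integral_rpow_sub_one_mul_rpow_neg
    {Ω : Type*} [MeasurableSpace Ω] {μ : Measure Ω} {A B : Ω → ℝ}
    (hA : Measurable A) (hB : Measurable B)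
    (hAB : ∀ᵐ ω ∂μ, 0 < A ω ∧ A ω ≤ B ω) (hpos : 0 < μ {ω | A ω < B ω})
    (hint : Integrable (fun ω => (A ω)⁻¹) μ) :
    StrictAntiOn (fun γ : ℝ => ∫ ω, A ω ^ (γ - 1) * B ω ^ (-γ) ∂μ) (Set.Ici 0) := by
  have integrable : ∀ γ : ℝ, 0 ≤ γ →
      Integrable (fun ω => A ω ^ (γ - 1) * B ω ^ (-γ)) μ := by
    intro γ hγ
    refine hint.mono' (by fun_prop) ?_
    filter_upwards [hAB] with ω ⟨h0, hle⟩
    have hb := h0.trans_le hle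
    rw [rpow_sub_one_mul_rpow_neg h0 hb, Real.norm_of_nonneg (by positivity)]
    exact mul_le_of_le_one_right (by positivity)
      (rpow_le_one (by positivity) ((div_le_one hb).2 hle) hγ)
  intro s hs t ht hst
  have hle : (fun ω => A ω ^ (t - 1) * B ω ^ (-t)) ≤ᵐ[μ]
      fun ω => A ω ^ (s - 1) * B ω ^ (-s) := by
    filter_upwards [hAB] with ω ⟨h0, hle⟩
    have hb := h0.trans_le hle
    rw [rpow_sub_one_mul_rpow_neg h0 hb, rpow_sub_one_mul_rpow_neg h0 hb]
    exact mul_le_mul_of_nonneg_left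
      (rpow_le_rpow_of_exponent_ge (by positivity) ((div_le_one hb).2 hle) hst.le)
      (by positivity)
  refine lt_of_le_of_ne (integral_mono_ae (integrable t ht) (integrable s hs) hle) fun heq => ?_
  have hae := (integral_eq_iff_of_ae_le (integrable t ht) (integrable s hs) hle).1 heq
  refine hpos.ne' (measure_eq_zero_iff_ae_notMem.2 ?_)
  filter_upwards [hAB, hae] with ω ⟨h0, hle⟩ h hlt
  have hb := h0.trans_le hle
  rw [rpow_sub_one_mul_rpow_neg h0 hb, rpow_sub_one_mul_rpow_neg h0 hb] at h
  exact (mul_lt_mul_of_pos_left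
    (rpow_lt_rpow_of_exponent_gt (by positivity) ((div_lt_one hb).2 hlt) hst)
    (by positivity : 0 < (A ω)⁻¹)).ne h

/-- Regularity of the interpolation parameter: the unique function `γ` on `[Tₙ, Tₙ₊₁]`
with values in `[0,1]` satisfying `g (γ T) = B₀ T` is strictly increasing and continuous
on `[Tₙ, Tₙ₊₁]`. -/
theorem spotLibor_interpolation_function_strictMono_continuous
    {Ω : Type*} [MeasurableSpace Ω] (μ : Measure Ω) [IsProbabilityMeasure μ]
    (A B : Ω → ℝ) (hA : Measurable A) (hB : Measurable B)
    (hAB : ∀ᵐ ω ∂μ, 0 < A ω ∧ A ω ≤ B ω)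
    (hpos : 0 < μ {ω | A ω < B ω})
    (hint : Integrable (fun ω => (A ω)⁻¹) μ)
    (g : ℝ → ℝ) (hg : ∀ γ : ℝ, g γ = ∫ ω, A ω ^ (γ - 1) * B ω ^ (-γ) ∂μ)
    (Tn Tn1 : ℝ) (hT : Tn < Tn1) (B₀ : ℝ → ℝ)
    (hB₀cont : ContinuousOn B₀ (Set.Icc Tn Tn1))
    (hB₀anti : StrictAntiOn B₀ (Set.Icc Tn Tn1))
    (hB₀n : B₀ Tn = g 0) (hB₀n1 : B₀ Tn1 = g 1)
    (γf : ℝ → ℝ)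
    (hγf : ∀ T ∈ Set.Icc Tn Tn1, γf T ∈ Set.Icc (0 : ℝ) 1 ∧ g (γf T) = B₀ T) :
    StrictMonoOn γf (Set.Icc Tn Tn1) ∧ ContinuousOn γf (Set.Icc Tn Tn1) := by
  have hanti : StrictAntiOn g (Set.Icc 0 1) := by
    rw [funext hg]
    exact (strictAntiOn_integral_rpow_sub_one_mul_rpow_neg hA hB hAB hpos hint).mono
      Set.Icc_subset_Ici_self
  have hmono : StrictMonoOn γf (Set.Icc Tn Tn1) := by
    intro x hx y hy hxy
    rw [← hanti.lt_iff_gt (hγf y hy).1 (hγf x hx).1, (hγf x hx).2, (hγf y hy).2]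
    exact hB₀anti hx hy hxy
  refine ⟨hmono, ?_⟩
  have hmaps : Set.MapsTo γf (Set.Icc Tn Tn1) (Set.Icc 0 1) := fun T h => (hγf T h).1
  have hsurj : Function.Surjective hmaps.restrict := by
    rintro ⟨s, hs⟩
    have hgs : g s ∈ Set.Icc (B₀ Tn1) (B₀ Tn) := by
      rw [hB₀n, hB₀n1]
      exact ⟨hanti.antitoneOn hs (by simp) hs.2, hanti.antitoneOn (by simp) hs hs.1⟩
    obtain ⟨T, hTmem, hTs⟩ := intermediate_value_Icc' hT.le hB₀cont hgs
    exact ⟨⟨T, hTmem⟩, Subtype.ext <|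
      hanti.injOn (hγf T hTmem).1 hs ((hγf T hTmem).2.trans hTs)⟩
  have hrestrict : Monotone hmaps.restrict := fun x y hxy =>
    hmono.monotoneOn x.2 y.2 hxy
  rw [continuousOn_iff_continuous_domRestrict]
  exact continuous_subtype_val.comp (hrestrict.continuous_of_surjective hsurj)
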